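/- Let A and B be topological spaces with A second-countable, and let f : A → B be a surjective local homeomorphism. Then f admits a Borel section: there exists a map s : B → A, measurable with respect to the Borel σ-algebras, such that f∘s = id_B. -/

import Mathlib

open MeasureTheory

noncomputable section

/-- A surjective local homeomorphism `f : A → B` from a
second-countable space admits a Borel section: a map `s : B → A`, measurable with
respect to the Borel σ-algebras, with `f ∘ s = id`. -/
theorem statement17 {A B : Type*} [TopologicalSpace A] [TopologicalSpace B]
    [MeasurableSpace A] [BorelSpace A] [MeasurableSpace B] [BorelSpace B]
    [SecondCountableTopology A] (f : A → B) (hf : IsLocalHomeomorph f)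
    (hsurj : Function.Surjective f) :
    ∃ s : B → A, Measurable s ∧ f ∘ s = id := by
  classical
  rcases isEmpty_or_nonempty A with hA | hA
  · have : IsEmpty B := ⟨fun b => hA.elim (hsurj b).choose⟩
    exact ⟨fun b => isEmptyElim b, measurable_of_empty _, funext fun b => isEmptyElim b⟩
  choose e hmem he using hf
  obtain ⟨S, hSc, hS⟩ := TopologicalSpace.countable_cover_nhds
    fun x => (e x).open_source.mem_nhds (hmem x)
  have hSne : S.Nonempty := by
    by_contra h
    rw [Set.not_nonempty_iff_eq_empty] at h
    obtain ⟨a⟩ := hA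
    have ha : a ∈ ⋃ x ∈ S, (e x).source := hS ▸ Set.mem_univ a
    simp [h] at ha
  obtain ⟨x, rfl⟩ := hSc.exists_eq_range hSne
  have hcover : ∀ b, ∃ n, b ∈ (e (x n)).target := by
    intro b
    obtain ⟨a, rfl⟩ := hsurj b
    have ha : a ∈ ⋃ y ∈ Set.range x, (e y).source := hS ▸ Set.mem_univ a
    simp only [Set.mem_iUnion, Set.mem_range, exists_prop, exists_exists_eq_and] at ha
    obtain ⟨n, hn⟩ := ha
    refine ⟨n, ?_⟩
    rw [he (x n)]
    exact (e (x n)).map_source hn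
  have hfind : Measurable fun b => Nat.find (hcover b) :=
    measurable_find hcover fun n => (e (x n)).open_target.measurableSet
  refine ⟨fun b => (e (x (Nat.find (hcover b)))).symm b, ?_, ?_⟩
  · rw [BorelSpace.measurable_eq (α := A)]
    refine measurable_generateFrom fun U hU => ?_
    have hpre : (fun b => (e (x (Nat.find (hcover b)))).symm b) ⁻¹' U =
        ⋃ n, (fun b => Nat.find (hcover b)) ⁻¹' {n} ∩
          ((e (x n)).target ∩ (e (x n)).symm ⁻¹' U) := by
      ext b
      simp only [Set.mem_preimage, Set.mem_iUnion, Set.mem_inter_iff, Set.mem_singleton_iff]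
      constructor
      · exact fun hb => ⟨_, rfl, Nat.find_spec (hcover b), hb⟩
      · rintro ⟨n, rfl, -, hb⟩
        exact hb
    rw [hpre]
    exact MeasurableSet.iUnion fun n => (hfind (measurableSet_singleton n)).inter
      ((e (x n)).symm.isOpen_inter_preimage hU).measurableSet
  · funext b
    have hb := (e (x (Nat.find (hcover b)))).right_inv (Nat.find_spec (hcover b))
    rwa [← he] at hb

end
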